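/- A commutative ring R with unity is (von Neumann) regular if and only if every simple R-module is injective. -/

import Mathlib

/-- The ideal `[x : M] = {r ∈ R | r • M ⊆ R x}` of `R` (colon ideal of the
cyclic submodule `Rx` in `M`). -/
def colonIdeal (R : Type*) [CommRing R] {M : Type*} [AddCommGroup M] [Module R M]
    (x : M) : Ideal R :=
  (Submodule.span R {x}).colon ⊤

/-- A nonzero ideal `I` of `R` is essential if `I ⊓ J ≠ 0` for every nonzero ideal `J`. -/
def IsEssentialIdeal (R : Type*) [CommRing R] (I : Ideal R) : Prop :=
  I ≠ ⊥ ∧ ∀ J : Ideal R, J ≠ ⊥ → I ⊓ J ≠ ⊥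

/-- `x ∈ M` is a full-annihilator if `x = 0` or there is a nonzero `y ∈ M` with
`[y : M] ≠ R` and `[x : M][y : M]M = 0`. -/
def IsFullAnnihilator (R : Type*) [CommRing R] {M : Type*} [AddCommGroup M] [Module R M]
    (x : M) : Prop :=
  x = 0 ∨ ∃ y : M, y ≠ 0 ∧ colonIdeal R y ≠ ⊤ ∧
    (colonIdeal R x * colonIdeal R y) • (⊤ : Submodule R M) = ⊥

/-- The annihilator `{r ∈ R | r • n = 0}` of an element `n` of an `R`-module. -/
def elemAnn (R : Type*) [CommRing R] {N : Type*} [AddCommGroup N] [Module R N]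
    (n : N) : Ideal R :=
  LinearMap.ker (LinearMap.toSpanSingleton R N n)

/-- An `R`-module `N` is singular if `Z(N) = N`, i.e. every element has essential
annihilator. -/
def IsSingularModule (R : Type*) [CommRing R] (N : Type*) [AddCommGroup N] [Module R N] : Prop :=
  ∀ n : N, IsEssentialIdeal R (elemAnn R n)

/-- `rad(N)`: the intersection of all maximal submodules of `N`. -/
def moduleRad (R : Type*) [CommRing R] (N : Type*) [AddCommGroup N] [Module R N] :
    Submodule R N :=
  sInf {P : Submodule R N | IsCoatom P}

/-- `Soc(M)`: the sum of all simple submodules of `M`. -/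
def socle (R : Type*) [CommRing R] (M : Type*) [AddCommGroup M] [Module R M] :
    Submodule R M :=
  sSup {N : Submodule R M | IsSimpleModule R ↥N}

/-- `M` has nonzero essential socle: `Soc(M)` is nonzero and intersects every nonzero
submodule nontrivially. -/
def HasNonzeroEssentialSocle (R : Type*) [CommRing R] (M : Type*) [AddCommGroup M]
    [Module R M] : Prop :=
  socle R M ≠ ⊥ ∧ ∀ L : Submodule R M, L ≠ ⊥ → socle R M ⊓ L ≠ ⊥

universe u

/-- Over a von Neumann regular commutative ring every simple module satisfies Baer's criterion. -/
theorem baer_of_isSimpleModule_of_regular {R : Type*} [CommRing R]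
    (hR : ∀ a : R, ∃ x : R, a ^ 2 * x = a) (N : Type*) [AddCommGroup N] [Module R N]
    [IsSimpleModule R N] : Module.Baer R N := by
  intro I g
  by_cases hg : ∀ i : I, g i = 0
  · exact ⟨0, fun x hx => by simp [hg]⟩
  push Not at hg
  obtain ⟨⟨a, ha⟩, hga⟩ := hg
  obtain ⟨x, hx⟩ := hR a
  let e : I := ⟨x * a, I.mul_mem_left x ha⟩
  have hea : a • e = ⟨a, ha⟩ := Subtype.ext (by
    change a * (x * a) = a
    linear_combination hx)
  have hee : (e : R) • e = e := Subtype.ext (by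
    change x * a * (x * a) = x * a
    linear_combination x * hx)
  have hge : g e ≠ 0 := fun h => hga (by rw [← hea, map_smul, h, smul_zero])
  refine ⟨LinearMap.toSpanSingleton R N (g e), fun i hi => ?_⟩
  obtain ⟨r, hr⟩ := IsSimpleModule.toSpanSingleton_surjective R hge (g ⟨i, hi⟩)
  rw [LinearMap.toSpanSingleton_apply] at hr ⊢
  have hcomm : i • e = (e : R) • (⟨i, hi⟩ : I) := Subtype.ext (mul_comm i (e : R))
  rw [← map_smul, hcomm, map_smul, ← hr, smul_comm, ← map_smul g (e : R), hee]

/-- If all residue fields at maximal ideals are injective, the ring is von Neumann regular. -/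
theorem regular_of_injective_quotient {R : Type*} [CommRing R]
    (hR : ∀ m : Ideal R, m.IsMaximal → Module.Injective R (R ⧸ m)) (a : R) :
    ∃ x : R, a ^ 2 * x = a := by
  by_contra hne
  let φ : R →ₗ[R] R := LinearMap.toSpanSingleton R R a
  let J : Ideal R := Submodule.comap φ (Ideal.span {a ^ 2})
  have hJ : J ≠ ⊤ := fun h => hne (by
    have h1 : φ 1 ∈ Ideal.span {a ^ 2} := (Ideal.eq_top_iff_one J).1 h
    obtain ⟨x, hx⟩ := Ideal.mem_span_singleton.1 h1
    exact ⟨x, by simpa [φ] using hx.symm⟩)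
  obtain ⟨m, hm, hJm⟩ := J.exists_le_maximal hJ
  have ham : a ∈ m := hJm (Ideal.mem_span_singleton.2 (by simp [φ, sq]))
  have hker : LinearMap.ker φ ≤ LinearMap.ker m.mkQ := by
    rw [Submodule.ker_mkQ]
    exact le_trans (fun r hr => by
      change φ r ∈ Ideal.span {a ^ 2}
      rw [LinearMap.mem_ker.1 hr]
      exact zero_mem _) hJm
  obtain ⟨h, hh⟩ := (hR m hm).out ((LinearMap.ker φ).liftQ φ le_rfl)
    (LinearMap.ker_eq_bot.1 (Submodule.ker_liftQ_eq_bot' _ _ rfl))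
    ((LinearMap.ker φ).liftQ m.mkQ hker)
  have h1 : h a = m.mkQ 1 := by
    have h2 := hh ((LinearMap.ker φ).mkQ 1)
    rw [Submodule.mkQ_apply, Submodule.liftQ_apply, Submodule.liftQ_apply] at h2
    rwa [show φ 1 = a from one_smul R a] at h2
  have h0 : h a = 0 := by
    obtain ⟨y, hy⟩ := m.mkQ_surjective (h 1)
    rw [← mul_one a, ← smul_eq_mul, map_smul, ← hy, ← map_smul, ← LinearMap.mem_ker,
      Submodule.ker_mkQ]
    exact m.mul_mem_right y ham
  refine hm.ne_top ((Ideal.eq_top_iff_one m).2 ?_)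
  rwa [h1, ← LinearMap.mem_ker, Submodule.ker_mkQ] at h0

theorem stmt8 {R : Type u} [CommRing R] [Nontrivial R] :
    (∀ a : R, ∃ x : R, a ^ 2 * x = a) ↔
    (∀ (N : Type u) [AddCommGroup N] [Module R N],
      IsSimpleModule R N → Module.Injective R N) := by
  refine ⟨fun hR N _ _ _ => (baer_of_isSimpleModule_of_regular hR N).injective,
    fun hN => regular_of_injective_quotient fun m hm => hN (R ⧸ m) ?_⟩
  exact isSimpleModule_iff_isCoatom.2 hm.out
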